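/- Let a b : ℝ with a < b and let f : ℝ → ℝ be continuous on the open interval (a,b). Suppose there exists a function g : ℝ → ℝ such that at every point x ∈ (a,b), g(x) is the right-handed derivative of f at x (i.e., (f x₁ - f x)/(x₁ - x) → g(x) as x₁ → x from the right) and g is monotone nondecreasing on (a,b). Then f is convex on (a,b). Conversely, if f is convex on (a,b), then the right-handed derivative exists at every point of (a,b) and defines a monotone nondecreasing function on (a,b). -/

import Mathlib

open Filter Topology

/-- The difference quotients of `f` at `x` from the right converge to `f'` exactly when `f'` is
the derivative of `f` within `[x, ∞)`. -/
theorem tendsto_div_sub_nhdsGT_iff_hasDerivWithinAt_Ici {f : ℝ → ℝ} {f' x : ℝ} :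
    Tendsto (fun y : ℝ => (f y - f x) / (y - x)) (𝓝[Set.Ioi x] x) (𝓝 f') ↔
      HasDerivWithinAt f f' (Set.Ici x) x := by
  rw [← hasDerivWithinAt_Ioi_iff_Ici, hasDerivWithinAt_iff_tendsto_slope' Set.self_notMem_Ioi,
    ← slope_fun_def_field]

/-- A lower bound for the right derivative bounds the slope from below. -/
theorem le_slope_of_le_deriv_right {f f' : ℝ → ℝ} {x y m : ℝ} (hxy : x < y)
    (hf : ContinuousOn f (Set.Icc x y))
    (hf' : ∀ t ∈ Set.Ico x y, HasDerivWithinAt f (f' t) (Set.Ici t) t)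
    (hm : ∀ t ∈ Set.Ico x y, m ≤ f' t) : m ≤ (f y - f x) / (y - x) := by
  have h := image_le_of_deriv_right_le_deriv_boundary
    (f := fun t => f x + m * (t - x)) (f' := fun _ => m) (by fun_prop)
    (fun t _ => by
      simpa using (((hasDerivWithinAt_id t (Set.Ici t)).sub_const x).const_mul m).const_add (f x))
    (by simp) hf hf' hm (Set.right_mem_Icc.2 hxy.le)
  rw [le_div_iff₀ (sub_pos.2 hxy)]
  linarith

/-- An upper bound for the right derivative bounds the slope from above. -/
theorem slope_le_of_deriv_right_le {f f' : ℝ → ℝ} {x y m : ℝ} (hxy : x < y)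
    (hf : ContinuousOn f (Set.Icc x y))
    (hf' : ∀ t ∈ Set.Ico x y, HasDerivWithinAt f (f' t) (Set.Ici t) t)
    (hm : ∀ t ∈ Set.Ico x y, f' t ≤ m) : (f y - f x) / (y - x) ≤ m := by
  have h := le_slope_of_le_deriv_right hxy hf.neg (fun t ht => (hf' t ht).neg)
    (fun t ht => neg_le_neg (hm t ht))
  rw [le_div_iff₀ (sub_pos.2 hxy)] at h
  rw [div_le_iff₀ (sub_pos.2 hxy)]
  simp only [Pi.neg_apply] at h
  linarith

/-- A continuous function on an open interval with a monotone right derivative is convex. -/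
theorem convexOn_Ioo_of_monotoneOn_deriv_right {f f' : ℝ → ℝ} {a b : ℝ}
    (hf : ContinuousOn f (Set.Ioo a b))
    (hf' : ∀ t ∈ Set.Ioo a b, HasDerivWithinAt f (f' t) (Set.Ici t) t)
    (hmono : MonotoneOn f' (Set.Ioo a b)) : ConvexOn ℝ (Set.Ioo a b) f := by
  refine convexOn_of_slope_mono_adjacent (convex_Ioo a b) fun {x y z} hx hz hxy hyz => ?_
  have hy : y ∈ Set.Ioo a b := ⟨hx.1.trans hxy, hyz.trans hz.2⟩
  have hxys : Set.Icc x y ⊆ Set.Ioo a b := Set.Icc_subset_Ioo hx.1 hy.2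
  have hyzs : Set.Icc y z ⊆ Set.Ioo a b := Set.Icc_subset_Ioo hy.1 hz.2
  calc (f y - f x) / (y - x) ≤ f' y :=
        slope_le_of_deriv_right_le hxy (hf.mono hxys)
          (fun t ht => hf' t (hxys (Set.Ico_subset_Icc_self ht)))
          fun t ht => hmono (hxys (Set.Ico_subset_Icc_self ht)) hy ht.2.le
    _ ≤ (f z - f y) / (z - y) :=
        le_slope_of_le_deriv_right hyz (hf.mono hyzs)
          (fun t ht => hf' t (hyzs (Set.Ico_subset_Icc_self ht)))
          fun t ht => hmono hy (hyzs (Set.Ico_subset_Icc_self ht)) ht.1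

/-- `f` continuous on `(a,b)` having at every point a right-handed derivative `g x` with
`g` monotone nondecreasing on `(a,b)` implies `f` is convex on `(a,b)`; conversely a
convex `f` on `(a,b)` has a right-handed derivative at every point of `(a,b)` which
defines a monotone nondecreasing function on `(a,b)`. -/
theorem convexOn_iff_monotone_rightDeriv
    (a b : ℝ) (hab : a < b) (f : ℝ → ℝ) (hcont : ContinuousOn f (Set.Ioo a b)) :
    ((∃ g : ℝ → ℝ,
        (∀ x ∈ Set.Ioo a b,
          Tendsto (fun x₁ : ℝ => (f x₁ - f x) / (x₁ - x)) (𝓝[Set.Ioi x] x) (𝓝 (g x))) ∧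
        MonotoneOn g (Set.Ioo a b)) →
      ConvexOn ℝ (Set.Ioo a b) f) ∧
    (ConvexOn ℝ (Set.Ioo a b) f →
      ∃ g : ℝ → ℝ,
        (∀ x ∈ Set.Ioo a b,
          Tendsto (fun x₁ : ℝ => (f x₁ - f x) / (x₁ - x)) (𝓝[Set.Ioi x] x) (𝓝 (g x))) ∧
        MonotoneOn g (Set.Ioo a b)) := by
  simp only [tendsto_div_sub_nhdsGT_iff_hasDerivWithinAt_Ici]
  refine ⟨fun ⟨g, hg, hmono⟩ => convexOn_Ioo_of_monotoneOn_deriv_right hcont hg hmono,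
    fun hf => ⟨fun x => derivWithin f (Set.Ioi x) x, fun x hx => ?_, ?_⟩⟩
  · rw [← hasDerivWithinAt_Ioi_iff_Ici]
    exact hf.hasDerivWithinAt_rightDeriv_of_mem_interior (by rwa [interior_Ioo])
  · simpa only [interior_Ioo] using hf.monotoneOn_rightDeriv
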